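/- Let X ~ N(μ_X, σ_X²) and let V_t = v · exp((X - σ²/2) t + σ W_t) with v, σ > 0, where W is a Brownian motion independent of X. Let F_t be a σ-algebra containing σ(V_s : s ≤ t) with respect to which the conditional law of X is N(X̂_t, Σ(t)). Then for 0 ≤ t < T and K > 0, P(V_T < K | F_t) = Φ((a'(t) - X̂_t (T - t)) / b'(t)), where a'(t) = log(K/V_t) + (σ²/2)(T - t) and b'(t) = √(T - t) · √(σ² + Σ(t)(T - t)). -/

import Mathlib

open MeasureTheory ProbabilityTheory Real

/-- The standard normal cumulative distribution function. -/
noncomputable def stdNormalCDF (x : ℝ) : ℝ :=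
  (gaussianReal 0 1 (Set.Iic x)).toReal

open scoped ENNReal NNReal

theorem measurable_measure_Iio (γ : Measure ℝ) : Measurable fun y : ℝ => γ (Set.Iio y) :=
  Monotone.measurable fun _ _ h => measure_mono (Set.Iio_subset_Iio h)

theorem measurable_measure_Iic (γ : Measure ℝ) : Measurable fun y : ℝ => γ (Set.Iic y) :=
  Monotone.measurable fun _ _ h => measure_mono (Set.Iic_subset_Iic.2 h)

theorem gaussianReal_Iic_toReal {v : ℝ≥0} (hv : v ≠ 0) (x : ℝ) :
    (gaussianReal 0 v (Set.Iic x)).toReal = stdNormalCDF (x / √v) := by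
  have hv' : (0 : ℝ) < √v := Real.sqrt_pos.2 (by positivity)
  have h : (gaussianReal 0 1).map (√(v : ℝ) * ·) = gaussianReal 0 v := by
    rw [gaussianReal_map_const_mul]
    congr 1
    · simp
    · ext
      simp [Real.sq_sqrt]
  rw [← h, Measure.map_apply (by fun_prop) measurableSet_Iic, stdNormalCDF]
  congr 2
  ext y
  simp [le_div_iff₀ hv', mul_comm]

theorem gaussianReal_Iio_toReal {v : ℝ≥0} (hv : v ≠ 0) (x : ℝ) :
    (gaussianReal 0 v (Set.Iio x)).toReal = stdNormalCDF (x / √v) := by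
  have := nullSingletonClass_gaussianReal (μ := 0) hv
  rw [measure_congr Iio_ae_eq_Iic, gaussianReal_Iic_toReal hv]

theorem stdNormalCDF_zero_lt_one : stdNormalCDF 0 < 1 := by
  refine lt_of_le_of_ne measureReal_le_one fun h => ?_
  have h' : gaussianReal 0 1 (Set.Iic (0 : ℝ)) = 1 := by
    rwa [stdNormalCDF, ENNReal.toReal_eq_one_iff] at h
  have h0 := (prob_compl_eq_zero_iff measurableSet_Iic).2 h'
  have := gaussianReal_absolutelyContinuous' 0 one_ne_zero h0
  simp at this

/-- If `N` has law `γ` independently of `m`, then `c * N` has law `γ.map (c * ·)` independently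
of `m`. -/
theorem map_restrict_const_mul {Ω : Type*} {m m0 : MeasurableSpace Ω} {P : Measure Ω}
    {γ : Measure ℝ} {N : Ω → ℝ} (hN : Measurable N) (c : ℝ)
    (h : ∀ A, MeasurableSet[m] A → (P.restrict A).map N = P A • γ)
    {A : Set Ω} (hA : MeasurableSet[m] A) :
    (P.restrict A).map (fun ω => c * N ω) = P A • γ.map (c * ·) := by
  rw [← Measure.map_smul, ← h A hA, Measure.map_map (by fun_prop) hN]
  rfl

section Independence

variable {Ω : Type*} {m m0 : MeasurableSpace Ω} {P : Measure Ω} [IsProbabilityMeasure P]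

/-- If `N` has law `γ` independently of `m`, then on every event of `m` it is also independent of
every `m`-measurable variable. -/
theorem map_prodMk_restrict_eq_prod {E : Type*} [MeasurableSpace E] (hm : m ≤ m0)
    {γ : Measure ℝ} [IsProbabilityMeasure γ] {Y : Ω → E} {N : Ω → ℝ}
    (hY : Measurable[m] Y) (hN : Measurable N)
    (h : ∀ A, MeasurableSet[m] A → (P.restrict A).map N = P A • γ)
    {A : Set Ω} (hA : MeasurableSet[m] A) :
    (P.restrict A).map (fun ω => (Y ω, N ω)) = ((P.restrict A).map Y).prod γ := by
  have hY' : Measurable Y := hY.mono hm le_rfl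
  have hYN : Measurable fun ω => (Y ω, N ω) := hY'.prodMk hN
  refine Measure.ext_prod fun {s t} hs ht => ?_
  have key := congrArg (fun μ => μ t) (h _ (hA.inter (hY hs)))
  simp only [Measure.smul_apply, smul_eq_mul] at key
  rw [Measure.map_apply hN ht, Measure.restrict_apply (hN ht)] at key
  rw [Measure.map_apply hYN (hs.prod ht), Measure.restrict_apply (hYN (hs.prod ht)),
    Measure.prod_prod, Measure.map_apply hY' hs, Measure.restrict_apply (hY' hs),
    Set.inter_comm (Y ⁻¹' s) A, ← key]
  congr 1
  ext ω
  simp only [Set.mem_inter_iff, Set.mem_preimage, Set.mem_prod]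
  tauto

/-- Freezing lemma: if `N` has law `γ` independently of `m` and `Y` is `m`-measurable, then
`P(N < Y | m) = γ(-∞, Y)`. -/
theorem condExp_indicator_lt (hm : m ≤ m0)
    {γ : Measure ℝ} [IsProbabilityMeasure γ] {Y N : Ω → ℝ}
    (hY : Measurable[m] Y) (hN : Measurable N)
    (h : ∀ A, MeasurableSet[m] A → (P.restrict A).map N = P A • γ) :
    P[Set.indicator {ω | N ω < Y ω} (fun _ => (1 : ℝ)) | m]
      =ᵐ[P] fun ω => (γ (Set.Iio (Y ω))).toReal := by
  have hY' : Measurable Y := hY.mono hm le_rfl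
  have hS : MeasurableSet {ω | N ω < Y ω} := measurableSet_lt hN hY'
  have hg : Measurable fun ω => γ (Set.Iio (Y ω)) := (measurable_measure_Iio γ).comp hY'
  have hgm : Measurable[m] fun ω => (γ (Set.Iio (Y ω))).toReal :=
    (measurable_measure_Iio γ).ennreal_toReal.comp hY
  refine (ae_eq_condExp_of_forall_setIntegral_eq hm
    ((integrable_const (1 : ℝ)).indicator hS) (fun A _ _ => ?_) (fun A hA _ => ?_)
    hgm.aestronglyMeasurable).symm
  · refine (Integrable.of_bound (C := 1) hg.ennreal_toReal.aestronglyMeasurable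
      (.of_forall fun ω => ?_)).integrableOn
    rw [Real.norm_of_nonneg ENNReal.toReal_nonneg]
    exact ENNReal.toReal_le_of_le_ofReal zero_le_one (by simpa using prob_le_one)
  · rw [integral_toReal hg.aemeasurable (.of_forall fun ω => measure_lt_top _ _),
      integral_indicator_const _ hS, smul_eq_mul, mul_one, Measure.real]
    congr 1
    have hC : MeasurableSet {p : ℝ × ℝ | p.2 < p.1} :=
      measurableSet_lt measurable_snd measurable_fst
    have key := congrArg (fun μ => μ {p : ℝ × ℝ | p.2 < p.1})
      (map_prodMk_restrict_eq_prod hm hY hN h hA)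
    rw [Measure.map_apply (hY'.prodMk hN) hC, Measure.prod_apply hC,
      lintegral_map (measurable_measure_prodMk_left hC) hY'] at key
    exact key.symm

/-- If `N₁` has law `γ₁` independently of `m` and `N₂` has law `γ₂` independently of `m ⊔ σ(N₁)`,
then `N₁ + N₂` has law `γ₁ ∗ γ₂` independently of `m`. -/
theorem map_restrict_add_eq_conv {m m' m0 : MeasurableSpace Ω} {P : Measure Ω}
    [IsProbabilityMeasure P] {γ₁ γ₂ : Measure ℝ}
    [IsProbabilityMeasure γ₁] [IsProbabilityMeasure γ₂]
    (hmm' : m ≤ m') (hm' : m' ≤ m0) {N₁ N₂ : Ω → ℝ}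
    (hN₁ : Measurable[m'] N₁) (hN₂ : Measurable N₂)
    (h₁ : ∀ A, MeasurableSet[m] A → (P.restrict A).map N₁ = P A • γ₁)
    (h₂ : ∀ A, MeasurableSet[m'] A → (P.restrict A).map N₂ = P A • γ₂)
    {A : Set Ω} (hA : MeasurableSet[m] A) :
    (P.restrict A).map (fun ω => N₁ ω + N₂ ω) = P A • (γ₁ ∗ γ₂) := by
  have hN₁' : Measurable N₁ := hN₁.mono hm' le_rfl
  have key := map_prodMk_restrict_eq_prod hm' hN₁ hN₂ h₂ (hmm' _ hA)
  rw [h₁ A hA, Measure.prod_smul_left] at key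
  rw [Measure.conv, ← Measure.map_smul, ← key,
    Measure.map_map (by fun_prop) (hN₁'.prodMk hN₂)]
  rfl

/-- If, conditionally on `m`, `X` has the distribution function of `Z + G` with `G` of law `γ` and
`Z` measurable for `m`, then `X - Z` has law `γ` independently of `m`. -/
theorem map_restrict_sub_of_condExp_Iic (hm : m ≤ m0)
    {γ : Measure ℝ} [IsProbabilityMeasure γ] {X Z : Ω → ℝ}
    (hX : Measurable X) (hZ : Measurable[m] Z)
    (h : ∀ x : ℝ, P[Set.indicator {ω | X ω ≤ x} (fun _ => (1 : ℝ)) | m]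
      =ᵐ[P] fun ω => (γ (Set.Iic (x - Z ω))).toReal)
    {A : Set Ω} (hA : MeasurableSet[m] A) :
    (P.restrict A).map (fun ω => X ω - Z ω) = P A • γ := by
  have hZ' : Measurable Z := hZ.mono hm le_rfl
  have conv_eq : ∀ B, MeasurableSet[m] B →
      (P.restrict B).map X = ((P.restrict B).map Z) ∗ γ := by
    intro B hB
    refine Measure.ext_of_Iic _ _ fun x => ?_
    have hg : Measurable fun ω => γ (Set.Iic (x - Z ω)) :=
      (measurable_measure_Iic γ).comp (measurable_const.sub hZ')
    have hS : MeasurableSet {ω | X ω ≤ x} := measurableSet_le hX measurable_const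
    have hint := setIntegral_condExp (μ := P) hm
      ((integrable_const (1 : ℝ)).indicator hS) hB
    rw [setIntegral_congr_ae (hm _ hB) ((h x).mono fun ω hω _ => hω),
      integral_toReal hg.aemeasurable (.of_forall fun ω => measure_lt_top _ _),
      integral_indicator_const _ hS, smul_eq_mul, mul_one, Measure.real,
      ENNReal.toReal_eq_toReal_iff' ?_ (measure_ne_top _ _)] at hint
    · have hC : MeasurableSet ((fun p : ℝ × ℝ => p.1 + p.2) ⁻¹' Set.Iic x) :=
        measurableSet_Iic.preimage (by fun_prop)
      rw [Measure.map_apply hX measurableSet_Iic, Measure.conv,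
        Measure.map_apply (by fun_prop) measurableSet_Iic, Measure.prod_apply hC,
        lintegral_map (measurable_measure_prodMk_left hC) hZ']
      refine hint.symm.trans (lintegral_congr fun ω => ?_)
      congr 1
      ext g
      simp [le_sub_iff_add_le']
    · refine ((lintegral_mono fun ω => prob_le_one).trans_lt ?_).ne
      simp
  have joint : (P.restrict A).map (fun ω => (Z ω, X ω))
      = (((P.restrict A).map Z).prod γ).map (fun p => (p.1, p.1 + p.2)) := by
    refine Measure.ext_prod fun {s t} hs ht => ?_
    have key := congrArg (fun μ => μ t) (conv_eq _ (hA.inter (hZ hs)))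
    have hadd : Measurable fun p : ℝ × ℝ => p.1 + p.2 := by fun_prop
    have hγ : (((P.restrict A).map Z).restrict s).prod γ
        = (((P.restrict A).map Z).prod γ).restrict (s ×ˢ Set.univ) := by
      rw [← Measure.prod_restrict, Measure.restrict_univ]
    simp only [Measure.conv] at key
    rw [Set.inter_comm, ← Measure.restrict_restrict (hZ' hs), ← Measure.restrict_map hZ' hs, hγ,
      Measure.map_apply hX ht, Measure.map_apply hadd ht,
      Measure.restrict_apply (hX ht), Measure.restrict_apply (hadd ht)] at key
    rw [Measure.map_apply (hZ'.prodMk hX) (hs.prod ht),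
      Measure.map_apply (by fun_prop) (hs.prod ht)]
    convert! key using 2
    · ext ω; simp [and_comm]
    · ext p; simp [and_comm]
  have hsub : Measurable fun p : ℝ × ℝ => p.2 - p.1 := by fun_prop
  have key := congrArg (Measure.map fun p : ℝ × ℝ => p.2 - p.1) joint
  rw [Measure.map_map hsub (hZ'.prodMk hX), Measure.map_map hsub (by fun_prop)] at key
  have hsnd : (fun p : ℝ × ℝ => p.2 - p.1) ∘ (fun p : ℝ × ℝ => (p.1, p.1 + p.2)) = Prod.snd := by
    ext p; simp
  rw [hsnd, Measure.map_snd_prod, Measure.map_apply hZ' MeasurableSet.univ] at key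
  simpa [Function.comp_def] using key

/-- A conditional distribution function cannot be constant and less than one. -/
theorem not_forall_condExp_Iic_eq_const (hm : m ≤ m0) {X : Ω → ℝ} (hX : Measurable X) {c : ℝ}
    (hc : c < 1) :
    ¬ ∀ x : ℝ, P[Set.indicator {ω | X ω ≤ x} (fun _ => (1 : ℝ)) | m] =ᵐ[P] fun _ => c := by
  intro h
  have hlim := tendsto_measure_Iic_atTop (P.map X)
  have hval : ∀ x, P.map X (Set.Iic x) = ENNReal.ofReal c := by
    intro x
    have hS : MeasurableSet {ω | X ω ≤ x} := measurableSet_le hX measurable_const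
    have hint := integral_condExp (μ := P) (f := Set.indicator {ω | X ω ≤ x} fun _ => (1 : ℝ)) hm
    rw [integral_congr_ae (h x), integral_indicator_const _ hS] at hint
    simp only [integral_const, probReal_univ, smul_eq_mul, one_mul, mul_one] at hint
    rw [Measure.map_apply hX measurableSet_Iic, hint, ofReal_measureReal]
    rfl
  have := Measure.isProbabilityMeasure_map (μ := P) hX.aemeasurable
  simp only [hval, measure_univ] at hlim
  have h1 := tendsto_nhds_unique tendsto_const_nhds hlim
  exact absurd h1 (by simpa using (ENNReal.ofReal_lt_one.2 hc).ne)

end Independence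

/-- Proposition 4.1, first part: if conditionally on `F_t` the drift `X`
is `N(X̂_t, Σ(t))`, the increment `W_T - W_t` is `N(0, T - t)` independent of
`F_t ∨ σ(X)`, and `V_T = V_t exp((X - σ²/2)(T - t) + σ (W_T - W_t))`, then
`P(V_T < K | F_t) = Φ((a'(t) - X̂_t (T - t)) / b'(t))` with
`a'(t) = log(K / V_t) + σ²/2 (T - t)` and `b'(t) = √(T-t) √(σ² + Σ(t)(T-t))`. -/
theorem merton_filtering_default_probability
    {Ω : Type*} (𝒢 : MeasurableSpace Ω) [m0 : MeasurableSpace Ω]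
    (P : Measure Ω) [IsProbabilityMeasure P] (h𝒢 : 𝒢 ≤ m0)
    (t T σ K Sig : ℝ) (ht : 0 ≤ t) (htT : t < T) (hσ : 0 < σ) (hK : 0 < K) (hSig : 0 ≤ Sig)
    (X Xhat Vt D VT : Ω → ℝ)
    (hX : Measurable[m0] X) (hXhat : Measurable[𝒢] Xhat)
    (hVt : Measurable[𝒢] Vt) (hVt_pos : ∀ ω, 0 < Vt ω)
    -- conditionally on `𝒢`, `X` is Gaussian with mean `Xhat` and variance `Sig`:
    (hcondX : ∀ x : ℝ,
      P[Set.indicator {ω | X ω ≤ x} (fun _ => (1:ℝ)) | 𝒢]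
        =ᵐ[P] fun ω => stdNormalCDF ((x - Xhat ω) / Real.sqrt Sig))
    -- the Brownian increment `D = W_T - W_t` is independent of `𝒢 ∨ σ(X)`:
    (hD : Measurable[m0] D)
    (hD_indep : Indep (MeasurableSpace.comap D (borel ℝ))
      (𝒢 ⊔ MeasurableSpace.comap X (borel ℝ)) P)
    (hD_law : P.map D = gaussianReal 0 (Real.toNNReal (T - t)))
    (hVT : ∀ ω, VT ω = Vt ω * Real.exp ((X ω - σ ^ 2 / 2) * (T - t) + σ * D ω)) :
    P[Set.indicator {ω | VT ω < K} (fun _ => (1:ℝ)) | 𝒢]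
      =ᵐ[P] fun ω =>
        stdNormalCDF (((Real.log (K / Vt ω) + σ ^ 2 / 2 * (T - t)) - Xhat ω * (T - t)) /
          (Real.sqrt (T - t) * Real.sqrt (σ ^ 2 + Sig * (T - t)))) := by
  have hτ : 0 < T - t := sub_pos.2 htT
  rcases hSig.eq_or_lt with rfl | hSig'
  · refine absurd (fun x => ?_)
      (not_forall_condExp_Iic_eq_const (P := P) h𝒢 hX stdNormalCDF_zero_lt_one)
    simpa using hcondX x
  have hv : Sig.toNNReal ≠ 0 := by simpa using hSig'
  have hG := fun A (hA : MeasurableSet[𝒢] A) =>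
    map_restrict_sub_of_condExp_Iic (P := P) (γ := gaussianReal 0 Sig.toNNReal) h𝒢 hX hXhat
      (fun x => by simpa [gaussianReal_Iic_toReal hv, hSig] using hcondX x) hA
  have hm' : 𝒢 ⊔ MeasurableSpace.comap X (borel ℝ) ≤ m0 := by
    rw [← BorelSpace.measurable_eq (α := ℝ)]
    exact sup_le h𝒢 hX.comap_le
  have hX' : Measurable[𝒢 ⊔ MeasurableSpace.comap X (borel ℝ)] X := by
    rw [← BorelSpace.measurable_eq (α := ℝ)]
    exact (comap_measurable X).mono le_sup_right le_rfl
  have hXhat' : Measurable[𝒢 ⊔ MeasurableSpace.comap X (borel ℝ)] Xhat :=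
    hXhat.mono le_sup_left le_rfl
  have hD' : ∀ A, MeasurableSet[𝒢 ⊔ MeasurableSpace.comap X (borel ℝ)] A →
      (P.restrict A).map D = P A • gaussianReal 0 (T - t).toNNReal := by
    intro A hA
    ext s hs
    have hind := (Indep_iff _ _ P).1 hD_indep (D ⁻¹' s) A
      ⟨s, by rwa [← BorelSpace.measurable_eq (α := ℝ)], rfl⟩ hA
    rw [Measure.map_apply hD hs, Measure.restrict_apply (hD hs), hind, ← hD_law,
      Measure.smul_apply, Measure.map_apply hD hs, smul_eq_mul, mul_comm]
  have hGm : Measurable[𝒢 ⊔ MeasurableSpace.comap X (borel ℝ)]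
      fun ω => (T - t) * (X ω - Xhat ω) := (hX'.sub hXhat').const_mul _
  have hXhat₀ : Measurable[m0] Xhat := hXhat.mono h𝒢 le_rfl
  set w : ℝ≥0 := .mk ((T - t) ^ 2) (sq_nonneg _) * Sig.toNNReal
    + .mk (σ ^ 2) (sq_nonneg _) * (T - t).toNNReal with hw
  have hN : ∀ A, MeasurableSet[𝒢] A →
      (P.restrict A).map (fun ω => (T - t) * (X ω - Xhat ω) + σ * D ω)
        = P A • gaussianReal 0 w := by
    intro A hA
    have hτG := fun A hA => map_restrict_const_mul (hX.sub hXhat₀) (T - t) hG (A := A) hA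
    have hσD := fun A hA => map_restrict_const_mul hD σ hD' (A := A) hA
    simp only [gaussianReal_map_const_mul] at hτG hσD
    rw [map_restrict_add_eq_conv (P := P) le_sup_left hm' hGm (hD.const_mul σ) hτG hσD hA,
      gaussianReal_conv_gaussianReal]
    simp [hw]
  have hwr : (w : ℝ) = (T - t) * (σ ^ 2 + Sig * (T - t)) := by
    simp only [hw, NNReal.coe_add, NNReal.coe_mul, NNReal.coe_mk, Real.coe_toNNReal _ hSig,
      Real.coe_toNNReal _ hτ.le]
    ring
  have hw0 : w ≠ 0 := by
    rw [← NNReal.coe_ne_zero, hwr]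
    positivity
  have hY : Measurable[𝒢] fun ω =>
      Real.log (K / Vt ω) + σ ^ 2 / 2 * (T - t) - Xhat ω * (T - t) :=
    ((Real.measurable_log.comp (hVt.const_div K)).add_const _).sub (hXhat.mul_const _)
  have hset : {ω | VT ω < K} = {ω | (T - t) * (X ω - Xhat ω) + σ * D ω
      < Real.log (K / Vt ω) + σ ^ 2 / 2 * (T - t) - Xhat ω * (T - t)} := by
    ext ω
    rw [Set.mem_ofPred_eq, Set.mem_ofPred_eq, hVT, ← lt_div_iff₀' (hVt_pos ω),
      ← Real.lt_log_iff_exp_lt (div_pos hK (hVt_pos ω))]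
    constructor <;> intro h <;> linarith
  rw [hset]
  refine (condExp_indicator_lt h𝒢 hY
    (((hX.sub hXhat₀).const_mul _).add (hD.const_mul σ)) hN).trans (.of_forall fun ω => ?_)
  simp only
  rw [gaussianReal_Iio_toReal hw0, hwr, Real.sqrt_mul hτ.le]
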